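/- Let Z := {0,1} × ({0,1} × {0,1}) and define the additive counterfactual utility ũ(d, (y₀, y₁)) := y₀ + y₁ (independent of d). Let p be the Dirac lottery at (0, (0, 1)) and q the Dirac lottery at (0, (0, 0)). Then p and q both assign probability 1 to the decision being 0, and for every v ∈ {0,1} the probability that the coordinate y₀ (the potential outcome under the taken decision 0) equals v is the same under p and q; yet E_p[ũ] = 1 > 0 = E_q[ũ]. Hence the preference relation represented by ũ (which satisfies Irrelevance of Counterfactual Correlation, since ũ is additive) strictly ranks p above q and therefore violates Irrelevance of Counterfactual Outcomes; in particular, given Completeness, Transitivity, Independence and Continuity, Irrelevance of Counterfactual Correlation is strictly weaker than Irrelevance of Counterfactual Outcomes. -/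

import Mathlib

/-- `p` is a lottery on the finite type `Z`. -/
def IsLottery {Z : Type*} [Fintype Z] (p : Z → ℝ) : Prop :=
  (∀ z, 0 ≤ p z) ∧ ∑ z, p z = 1

/-- Expected utility of lottery `p` under utility `u`. -/
noncomputable def expUtil {Z : Type*} [Fintype Z] (u p : Z → ℝ) : ℝ :=
  ∑ z, u z * p z

/-- Mixture `α p + (1 - α) q`. -/
def mix {Z : Type*} (α : ℝ) (p q : Z → ℝ) : Z → ℝ :=
  fun z => α * p z + (1 - α) * q z

/-- Strict preference `p ≻ q`. -/
def StrictPref {Z : Type*} (R : (Z → ℝ) → (Z → ℝ) → Prop) (p q : Z → ℝ) : Prop :=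
  R p q ∧ ¬ R q p

/-- Completeness on lotteries. -/
def CompleteAx {Z : Type*} [Fintype Z] (R : (Z → ℝ) → (Z → ℝ) → Prop) : Prop :=
  ∀ p q : Z → ℝ, IsLottery p → IsLottery q → (R p q ∨ R q p)

/-- Transitivity on lotteries. -/
def TransitiveAx {Z : Type*} [Fintype Z] (R : (Z → ℝ) → (Z → ℝ) → Prop) : Prop :=
  ∀ p q r : Z → ℝ, IsLottery p → IsLottery q → IsLottery r → R p q → R q r → R p r

/-- vNM Independence on lotteries. -/
def IndependenceAx {Z : Type*} [Fintype Z] (R : (Z → ℝ) → (Z → ℝ) → Prop) : Prop :=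
  ∀ p q r : Z → ℝ, IsLottery p → IsLottery q → IsLottery r →
    ∀ α : ℝ, 0 < α → α ≤ 1 →
      StrictPref R p q → StrictPref R (mix α p r) (mix α q r)

/-- vNM Continuity on lotteries. -/
def ContinuityAx {Z : Type*} [Fintype Z] (R : (Z → ℝ) → (Z → ℝ) → Prop) : Prop :=
  ∀ p q r : Z → ℝ, IsLottery p → IsLottery q → IsLottery r →
    StrictPref R p q → StrictPref R q r →
      ∃ α β : ℝ, 0 < α ∧ α < 1 ∧ 0 < β ∧ β < 1 ∧
        StrictPref R (mix α p r) q ∧ StrictPref R q (mix β p r)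

/-- The potential outcome space `{0,1} × ({0,1} × {0,1})`: a decision and two binary
potential outcomes `(y₀, y₁)`. -/
abbrev Z14 := Fin 2 × (Fin 2 × Fin 2)

/-- The additive counterfactual utility `ũ(d, (y₀, y₁)) = y₀ + y₁`. -/
noncomputable def u14 : Z14 → ℝ := fun z => ((z.2.1 : ℕ) : ℝ) + ((z.2.2 : ℕ) : ℝ)

/-- The preference relation represented by `u14` via expected utility. -/
noncomputable def R14 : (Z14 → ℝ) → (Z14 → ℝ) → Prop :=
  fun p q => expUtil u14 p ≥ expUtil u14 q

/-- Probability that the decision equals `d`. -/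
noncomputable def probDec14 (p : Z14 → ℝ) (d : Fin 2) : ℝ :=
  ∑ z, if z.1 = d then p z else 0

/-- Probability that the potential outcome coordinate `y_k` equals `v`. -/
noncomputable def probOut14 (p : Z14 → ℝ) (k : Fin 2) (v : Fin 2) : ℝ :=
  ∑ z, if (if k = 0 then z.2.1 else z.2.2) = v then p z else 0

/-- Irrelevance of Counterfactual Outcomes on `Z14`. -/
def IOC14 (R : (Z14 → ℝ) → (Z14 → ℝ) → Prop) : Prop :=
  ∀ p q : Z14 → ℝ, IsLottery p → IsLottery q → ∀ d : Fin 2,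
    probDec14 p d = 1 → probDec14 q d = 1 →
    (∀ v : Fin 2, probOut14 p d v = probOut14 q d v) →
    (R p q ∧ R q p)

/-- Irrelevance of Counterfactual Correlation on `Z14`. -/
def ICC14 (R : (Z14 → ℝ) → (Z14 → ℝ) → Prop) : Prop :=
  ∀ p q : Z14 → ℝ, IsLottery p → IsLottery q → ∀ d : Fin 2,
    probDec14 p d = 1 → probDec14 q d = 1 →
    (∀ (k : Fin 2) (v : Fin 2), probOut14 p k v = probOut14 q k v) →
    (R p q ∧ R q p)

/-- Dirac lottery at `(0, (0, 1))`. -/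
noncomputable def p14 : Z14 → ℝ := fun z => if z = (0, (0, 1)) then 1 else 0

/-- Dirac lottery at `(0, (0, 0))`. -/
noncomputable def q14 : Z14 → ℝ := fun z => if z = (0, (0, 0)) then 1 else 0

theorem expUtil_mix {Z : Type*} [Fintype Z] (u p q : Z → ℝ) (α : ℝ) :
    expUtil u (mix α p q) = α * expUtil u p + (1 - α) * expUtil u q := by
  simp only [expUtil, mix, Finset.mul_sum, ← Finset.sum_add_distrib]
  exact Finset.sum_congr rfl fun z _ => by ring

theorem strictPref_R14_iff (p q : Z14 → ℝ) :
    StrictPref R14 p q ↔ expUtil u14 q < expUtil u14 p := by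
  simp only [StrictPref, R14, ge_iff_le, not_le]
  exact ⟨And.right, fun h => ⟨h.le, h⟩⟩

theorem isLottery_ite_eq {Z : Type*} [Fintype Z] [DecidableEq Z] (a : Z) :
    IsLottery fun z => if z = a then (1 : ℝ) else 0 :=
  ⟨fun z => by positivity, by simp⟩

theorem expUtil_u14_eq_probOut14 (p : Z14 → ℝ) :
    expUtil u14 p = probOut14 p 0 1 + probOut14 p 1 1 := by
  simp [expUtil, u14, probOut14, Fintype.sum_prod_type, Fin.sum_univ_two]
  ring

theorem independenceAx_R14 : IndependenceAx R14 := by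
  intro p q r _ _ _ α hα _ h
  rw [strictPref_R14_iff] at h ⊢
  rw [expUtil_mix, expUtil_mix]
  gcongr

theorem continuityAx_R14 : ContinuityAx R14 := by
  intro p q r _ _ _ hpq hqr
  simp only [strictPref_R14_iff, expUtil_mix] at hpq hqr ⊢
  set a := expUtil u14 p
  set b := expUtil u14 q
  set c := expUtil u14 r
  have hac : 0 < a - c := by linarith
  obtain ⟨t, ht⟩ : ∃ t, t * (a - c) = b - c := ⟨(b - c) / (a - c), div_mul_cancel₀ _ hac.ne'⟩
  have ht₀ : 0 < t := pos_of_mul_pos_left (by linarith) hac.le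
  have ht₁ : t < 1 := lt_of_mul_lt_mul_right (by linarith) hac.le
  refine ⟨(t + 1) / 2, t / 2, ?_, ?_, ?_, ?_, ?_, ?_⟩ <;> linarith

theorem icc14_R14 : ICC14 R14 := by
  intro p q _ _ d _ _ h
  have heq : expUtil u14 p = expUtil u14 q := by
    rw [expUtil_u14_eq_probOut14, expUtil_u14_eq_probOut14, h, h]
  exact ⟨heq.ge, heq.le⟩

/-- The additive utility `ũ(d,(y₀,y₁)) = y₀ + y₁` represents a relation that satisfies
the vNM axioms and Irrelevance of Counterfactual Correlation, yet strictly ranks the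
Dirac lottery at `(0,(0,1))` above that at `(0,(0,0))`, although both assign probability
1 to decision 0 and agree on the distribution of the realized coordinate `y₀`. Hence it
violates Irrelevance of Counterfactual Outcomes: given the vNM axioms, ICC is strictly
weaker than IOC. -/
theorem icc_strictly_weaker_than_ioc :
    IsLottery p14 ∧ IsLottery q14 ∧
    probDec14 p14 0 = 1 ∧ probDec14 q14 0 = 1 ∧
    (∀ v : Fin 2, probOut14 p14 0 v = probOut14 q14 0 v) ∧
    expUtil u14 p14 = 1 ∧ expUtil u14 q14 = 0 ∧
    StrictPref R14 p14 q14 ∧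
    CompleteAx R14 ∧ TransitiveAx R14 ∧ IndependenceAx R14 ∧ ContinuityAx R14 ∧
    ICC14 R14 ∧ ¬ IOC14 R14 := by
  have hp : IsLottery p14 := isLottery_ite_eq _
  have hq : IsLottery q14 := isLottery_ite_eq _
  have hdp : probDec14 p14 0 = 1 := by
    simp [probDec14, p14, Fintype.sum_prod_type, -Finset.sum_boole]
  have hdq : probDec14 q14 0 = 1 := by
    simp [probDec14, q14, Fintype.sum_prod_type, -Finset.sum_boole]
  have hout : ∀ v : Fin 2, probOut14 p14 0 v = probOut14 q14 0 v := by
    intro v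
    fin_cases v <;> simp [probOut14, p14, q14, Fintype.sum_prod_type, -Finset.sum_boole]
  have hup : expUtil u14 p14 = 1 := by simp [expUtil, u14, p14]
  have huq : expUtil u14 q14 = 0 := by simp [expUtil, u14, q14]
  have hpref : StrictPref R14 p14 q14 := by
    rw [strictPref_R14_iff, hup, huq]
    exact one_pos
  exact ⟨hp, hq, hdp, hdq, hout, hup, huq, hpref, fun _ _ _ _ => le_total _ _,
    fun _ _ _ _ _ _ hpq hqr => hqr.trans hpq, independenceAx_R14, continuityAx_R14, icc14_R14,
    fun hioc => hpref.2 (hioc p14 q14 hp hq 0 hdp hdq hout).2⟩
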